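/- Suppose (q,k₀) ∈ {(2,3),(3,2)} and k ≥ k₀. Fix t ∈ {0,1,…,[k]_q − 1} and an integer α. Let r = q^{k−1}·t − [k]_q·α and s′ = (q·r − t)/[k]_q + 1, and suppose q·r ≥ k. If there is no LCD [q·r, k, (q−1)·r] code over 𝔽_q with dual distance d⊥ ≥ 2, then for every integer s ≥ s′ with [k]_q·s + t ≥ k, there is no LCD [[k]_q·s + t, k, q^{k−1}·s + α] code over 𝔽_q. -/

import Mathlib

open Matrix Finset

/-- The (Hamming) weight of a vector. -/
def wt {R : Type*} [Zero R] [DecidableEq R] {n : ℕ} (x : Fin n → R) : ℕ :=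
  (Finset.univ.filter fun i => x i ≠ 0).card

/-- The dual code of a linear code, w.r.t. the standard inner product. -/
def dualCode {R : Type*} [CommRing R] {n : ℕ} (C : Submodule R (Fin n → R)) :
    Submodule R (Fin n → R) where
  carrier := {x | ∀ y ∈ C, ∑ i, x i * y i = 0}
  add_mem' := by
    intro a b ha hb y hy
    have ha' := ha y hy
    have hb' := hb y hy
    simp only [Set.mem_setOf_eq, Pi.add_apply, add_mul, Finset.sum_add_distrib, ha', hb',
      add_zero]
  zero_mem' := by intro y hy; simp
  smul_mem' := by
    intro c x hx y hy
    have h := hx y hy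
    simp only [Set.mem_setOf_eq, Pi.smul_apply, smul_eq_mul, mul_assoc, ← Finset.mul_sum, h,
      mul_zero]

/-- A linear code is LCD if it intersects its dual trivially. -/
def IsLCD {R : Type*} [CommRing R] {n : ℕ} (C : Submodule R (Fin n → R)) : Prop :=
  C ⊓ dualCode C = ⊥

/-- `C` has minimum weight `d`. -/
def HasMinWeight {R : Type*} [CommRing R] [DecidableEq R] {n : ℕ}
    (C : Submodule R (Fin n → R)) (d : ℕ) : Prop :=
  (∃ x ∈ C, x ≠ 0 ∧ wt x = d) ∧ ∀ x ∈ C, x ≠ 0 → d ≤ wt x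

/-- The dual distance of `C` is at least `d`. -/
def DualDistGe {R : Type*} [CommRing R] [DecidableEq R] {n : ℕ}
    (C : Submodule R (Fin n → R)) (d : ℕ) : Prop :=
  ∀ x ∈ dualCode C, x ≠ 0 → d ≤ wt x

/-- A monomial matrix: exactly one nonzero entry in each row and column. -/
def IsMonomial {R : Type*} [CommRing R] {n : ℕ} (P : Matrix (Fin n) (Fin n) R) : Prop :=
  ∃ (σ : Equiv.Perm (Fin n)) (c : Fin n → R), (∀ i, c i ≠ 0) ∧
    ∀ i j, P i j = if σ i = j then c i else 0

/-- Two codes of the same length are equivalent if one is the image of the other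
under (right) multiplication by a monomial matrix. -/
def codeEquiv {R : Type*} [CommRing R] {n : ℕ} (C₁ C₂ : Submodule R (Fin n → R)) : Prop :=
  ∃ P : Matrix (Fin n) (Fin n) R, IsMonomial P ∧ C₂ = C₁.map (Matrix.vecMulLinear P)

/-- `G` is a generator matrix of `C`: the rows of `G` form a basis of `C`. -/
def IsGenMatrix {R : Type*} [CommRing R] {k n : ℕ} (C : Submodule R (Fin n → R))
    (G : Matrix (Fin k) (Fin n) R) : Prop :=
  LinearIndependent R (fun i : Fin k => G i) ∧
    Submodule.span R (Set.range fun i : Fin k => G i) = C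

/-- The code generated by the rows of a matrix. -/
def rowSpace {R : Type*} [CommRing R] {k n : ℕ} (G : Matrix (Fin k) (Fin n) R) :
    Submodule R (Fin n → R) :=
  Submodule.span R (Set.range fun i : Fin k => G i)

/-- `[k]_q = (q^k - 1)/(q - 1) = 1 + q + ⋯ + q^(k-1)`. -/
def qrep (q k : ℕ) : ℕ := ∑ i ∈ Finset.range k, q ^ i

/-- The columns of the simplex-code generator matrix `S_{q,k}`, defined inductively. -/
def simplexCol (q : ℕ) : (k : ℕ) → ℕ → (Fin k → ZMod q)
  | 0, _ => fun i => i.elim0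
  | (k+1), j =>
    if j < qrep q k then Fin.snoc (simplexCol q k j) 0
    else if j = qrep q k then Fin.snoc (fun _ => 0) 1
    else Fin.snoc (simplexCol q k ((j - qrep q k - 1) % qrep q k))
      (((j - qrep q k - 1) / qrep q k + 1 : ℕ) : ZMod q)

/-- The generator matrix `S_{q,k}` of the simplex code. -/
def simplexMatrix (q k : ℕ) : Matrix (Fin k) (Fin (qrep q k)) (ZMod q) :=
  Matrix.of fun i j => simplexCol q k (j : ℕ) i

/-- Juxtaposition `(A | B)` of two matrices. -/
def hcat {R : Type*} {k a b : ℕ} (A : Matrix (Fin k) (Fin a) R) (B : Matrix (Fin k) (Fin b) R) :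
    Matrix (Fin k) (Fin (a + b)) R :=
  Matrix.of fun i j =>
    if h : (j : ℕ) < a then A i ⟨j, h⟩ else B i ⟨(j : ℕ) - a, by have := j.isLt; omega⟩

/-- `A^{(s)}`: juxtaposition of `s` copies of `A`. -/
def reps {R : Type*} {k r : ℕ} (A : Matrix (Fin k) (Fin r) R) (s : ℕ) :
    Matrix (Fin k) (Fin (r * s)) R :=
  Matrix.of fun i j => A i ⟨(j : ℕ) % r,
    Nat.mod_lt _ (Nat.pos_of_ne_zero fun hr => by subst hr; simpa using j.isLt)⟩

/-- The list of columns of `G_{q,k}(m)`: `m i` copies of the `i`-th column of `S_{q,k}`. -/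
def colList (q k : ℕ) (m : Fin (qrep q k) → ℕ) : List (Fin k → ZMod q) :=
  (List.finRange (qrep q k)).flatMap fun i => List.replicate (m i) (simplexCol q k (i : ℕ))

lemma colList_length (q k : ℕ) (m : Fin (qrep q k) → ℕ) :
    (colList q k m).length = ∑ i, m i := by
  simp [colList, List.length_flatMap, Function.comp_def]
  rw [← List.ofFn_eq_map, List.sum_ofFn]

/-- The matrix `G_{q,k}(m)`, consisting of `m i` copies of the `i`-th column of `S_{q,k}`. -/
def Gqk (q k : ℕ) (m : Fin (qrep q k) → ℕ) : Matrix (Fin k) (Fin (∑ i, m i)) (ZMod q) :=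
  Matrix.of fun i j => (colList q k m).get (Fin.cast (colList_length q k m).symm j) i


section PointSets

variable {F : Type*} [Field F] [Fintype F] [DecidableEq F] {k : ℕ}

/-- The number of vectors not orthogonal to `v`. -/
def nonorthCard (v : Fin k → F) : ℕ := #{u : Fin k → F | u ⬝ᵥ v ≠ 0}

/-- The number of vectors orthogonal to neither `v` nor `w`. -/
def nonorthCard₂ (v w : Fin k → F) : ℕ := #{u : Fin k → F | u ⬝ᵥ v ≠ 0 ∧ u ⬝ᵥ w ≠ 0}

lemma card_affine_ne_zero (a b : F) (ha : a ≠ 0) :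
    #{c : F | b + c * a ≠ 0} + 1 = Fintype.card F := by
  have h : ({c : F | b + c * a ≠ 0} : Finset F) = Finset.univ.erase (-b / a) := by
    ext c
    simp only [ne_eq, mem_filter, mem_univ, true_and, mem_erase, and_true]
    rw [eq_div_iff ha, eq_neg_iff_add_eq_zero, add_comm]
  rw [h, card_erase_add_one (mem_univ _), card_univ]

lemma nonorthCard_eq (v : Fin k → F) (hv : v ≠ 0) :
    Fintype.card F * nonorthCard v + Fintype.card F ^ k =
      Fintype.card F * Fintype.card F ^ k := by
  obtain ⟨j, hj⟩ := Function.ne_iff.mp hv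
  set e : Fin k → F := Pi.single j (v j)⁻¹
  have he : e ⬝ᵥ v = 1 := by
    simp only [e, single_dotProduct]
    exact inv_mul_cancel₀ hj
  have h1 (c : F) : ∑ u : Fin k → F, (if u ⬝ᵥ v + c * 1 ≠ 0 then 1 else 0) = nonorthCard v := by
    rw [nonorthCard, card_filter]
    exact Fintype.sum_equiv (Equiv.addRight (c • e)) _ _ fun u ↦ by
      simp [add_dotProduct, smul_dotProduct, he]
  have h2 : ∑ c : F, ∑ u : Fin k → F, (if u ⬝ᵥ v + c * 1 ≠ 0 then 1 else 0) =
      Fintype.card F * nonorthCard v := by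
    simp_rw [h1]; simp
  rw [sum_comm] at h2
  have h3 : ∑ u : Fin k → F, (∑ c : F, (if u ⬝ᵥ v + c * 1 ≠ 0 then 1 else 0) + 1) =
      ∑ u : Fin k → F, Fintype.card F := by
    refine sum_congr rfl fun u _ ↦ ?_
    rw [← card_filter, card_affine_ne_zero 1 _ one_ne_zero]
  rw [sum_add_distrib, h2] at h3
  simpa [mul_comm] using h3

lemma nonorthCard_eq_of_ne_zero (v w : Fin k → F) (hv : v ≠ 0) (hw : w ≠ 0) :
    nonorthCard v = nonorthCard w := by
  have h := nonorthCard_eq v hv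
  rw [← nonorthCard_eq w hw] at h
  exact Nat.eq_of_mul_eq_mul_left Fintype.card_pos (Nat.add_right_cancel h)

lemma nonorthCard_pos (v : Fin k → F) (hv : v ≠ 0) : 0 < nonorthCard v := by
  obtain ⟨j, hj⟩ := Function.ne_iff.mp hv
  exact card_pos.mpr ⟨Pi.single j 1, by simpa using hj⟩

lemma nonorthCard₂_eq (v w : Fin k → F) (hw : w ≠ 0) (hvw : ∀ c : F, v + c • w ≠ 0) :
    Fintype.card F * nonorthCard₂ v w + nonorthCard w = Fintype.card F * nonorthCard w := by
  have hv : v ≠ 0 := by simpa using hvw 0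
  have h1 (u : Fin k → F) :
      (∑ c : F, if u ⬝ᵥ (v + c • w) ≠ 0 then 1 else 0) + (if u ⬝ᵥ w ≠ 0 then 1 else 0) +
        Fintype.card F * (if u ⬝ᵥ v ≠ 0 ∧ u ⬝ᵥ w ≠ 0 then 1 else 0) =
      Fintype.card F * (if u ⬝ᵥ w ≠ 0 then 1 else 0) +
        Fintype.card F * (if u ⬝ᵥ v ≠ 0 then 1 else 0) := by
    simp only [dotProduct_add, dotProduct_smul, smul_eq_mul]
    by_cases h : u ⬝ᵥ w = 0
    · by_cases h' : u ⬝ᵥ v = 0 <;> simp [h, h']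
    · rw [← card_filter, if_pos h, card_affine_ne_zero _ _ h]
      simp [h]
  have h2 := sum_congr (rfl : (univ : Finset (Fin k → F)) = univ) fun u _ ↦ h1 u
  simp only [sum_add_distrib, ← mul_sum] at h2
  rw [sum_comm] at h2
  simp only [← card_filter] at h2
  have h3 : ∑ c : F, #{u : Fin k → F | u ⬝ᵥ (v + c • w) ≠ 0} =
      Fintype.card F * nonorthCard w := by
    refine (sum_congr rfl fun c _ ↦ nonorthCard_eq_of_ne_zero _ _ (hvw c) hw).trans ?_
    simp
  have h4 := nonorthCard_eq_of_ne_zero v w hv hw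
  rw [h3] at h2
  change _ + nonorthCard w + _ * nonorthCard₂ v w = _ * nonorthCard w + _ * nonorthCard v at h2
  rw [h4] at h2
  omega

lemma nonorthCard₂_smul (v : Fin k → F) (c : F) (hc : c ≠ 0) :
    nonorthCard₂ v (c • v) = nonorthCard v := by
  simp [nonorthCard₂, nonorthCard, dotProduct_smul, hc]

/-- `R` contains exactly one representative of every point of the projective space. -/
def IsPointSet (R : Finset (Fin k → F)) : Prop :=
  0 ∉ R ∧ ∀ v : Fin k → F, v ≠ 0 → ∃! p, p ∈ R ∧ ∃ c : F, c ≠ 0 ∧ v = c • p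

omit [DecidableEq F] in
lemma exists_isPointSet : ∃ R : Finset (Fin k → F), IsPointSet R := by
  classical
  refine ⟨(Set.range (Projectivization.rep (K := F) (V := Fin k → F))).toFinite.toFinset, ?_, ?_⟩
  · simp only [Set.Finite.mem_toFinset, Set.mem_range, not_exists]
    exact fun p ↦ p.rep_nonzero
  · intro v hv
    refine ⟨(Projectivization.mk F v hv).rep, ⟨by simp, ?_⟩, ?_⟩
    · obtain ⟨a, ha⟩ := Projectivization.exists_smul_eq_mk_rep F v hv
      refine ⟨(a⁻¹ : Fˣ), by simp, ?_⟩
      rw [← ha]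
      simp [Units.smul_def, smul_smul]
    · rintro _ ⟨hp, c, hc, hvc⟩
      obtain ⟨p, rfl⟩ := by simpa using hp
      congr 1
      conv_lhs => rw [← p.mk_rep]
      rw [Projectivization.mk_eq_mk_iff']
      exact ⟨c⁻¹, by rw [hvc, smul_smul, inv_mul_cancel₀ hc, one_smul]⟩

/-- The number of members of the family `g` proportional to `p`. -/
def pointMult {ι : Type*} [Fintype ι] (g : ι → Fin k → F) (p : Fin k → F) : ℕ :=
  #{i | ∃ c : F, c ≠ 0 ∧ g i = c • p}

lemma sum_eq_sum_pointMult {ι A : Type*} [Fintype ι] [AddCommMonoid A]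
    {R : Finset (Fin k → F)} (hR : IsPointSet R) (g : ι → Fin k → F) (f : (Fin k → F) → A)
    (hf0 : f 0 = 0) (hf : ∀ c : F, c ≠ 0 → ∀ v, f (c • v) = f v) :
    ∑ i, f (g i) = ∑ p ∈ R, pointMult g p • f p := by
  have h1 (i : ι) : f (g i) = ∑ p ∈ R, if ∃ c : F, c ≠ 0 ∧ g i = c • p then f p else 0 := by
    by_cases h : g i = 0
    · rw [h, hf0, sum_eq_zero]
      intro p hp
      rw [if_neg]
      rintro ⟨c, hc, h0⟩
      exact hR.1 ((smul_eq_zero.mp h0.symm).resolve_left hc ▸ hp)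
    · obtain ⟨p, ⟨hp, c, hc, hpc⟩, huniq⟩ := hR.2 _ h
      rw [sum_eq_single_of_mem p hp, if_pos ⟨c, hc, hpc⟩, hpc, hf c hc]
      intro b hb hne
      rw [if_neg]
      exact fun h' ↦ hne (huniq b ⟨hb, h'⟩)
  simp_rw [h1]
  rw [sum_comm]
  refine sum_congr rfl fun p _ ↦ ?_
  rw [← sum_filter, sum_const, pointMult]

lemma pointMult_id (p : Fin k → F) (hp : p ≠ 0) :
    pointMult (fun v : Fin k → F ↦ v) p = Fintype.card F - 1 := by
  have h : ({v : Fin k → F | ∃ c : F, c ≠ 0 ∧ v = c • p} : Finset (Fin k → F)) =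
      (univ.erase (0 : F)).image fun c ↦ c • p := by
    ext v
    simp [eq_comm]
  rw [pointMult, h, card_image_of_injective _ (smul_left_injective F hp)]
  simp

lemma sum_eq_smul_sum_pointSet {A : Type*} [AddCommMonoid A]
    {R : Finset (Fin k → F)} (hR : IsPointSet R) (f : (Fin k → F) → A)
    (hf0 : f 0 = 0) (hf : ∀ c : F, c ≠ 0 → ∀ v, f (c • v) = f v) :
    ∑ v, f v = (Fintype.card F - 1) • ∑ p ∈ R, f p := by
  rw [sum_eq_sum_pointMult hR (fun v ↦ v) f hf0 hf, ← sum_nsmul]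
  refine sum_congr rfl fun p hp ↦ ?_
  rw [pointMult_id p fun h ↦ hR.1 (h ▸ hp)]

lemma card_pointSet {R : Finset (Fin k → F)} (hR : IsPointSet R) :
    (Fintype.card F - 1) * #R + 1 = Fintype.card F ^ k := by
  have h := sum_eq_smul_sum_pointSet hR (fun v ↦ if v ≠ 0 then 1 else 0) (by simp)
    (by intro c hc v; simp [hc])
  rw [← card_filter, ← card_filter, filter_true_of_mem (s := R) fun p hp ↦ ne_of_mem_of_not_mem hp hR.1] at h
  rw [← smul_eq_mul, ← h, filter_ne', card_erase_add_one (mem_univ _)]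
  simp

lemma card_pointSet_nonorth {R : Finset (Fin k → F)} (hR : IsPointSet R) (u : Fin k → F) :
    (Fintype.card F - 1) * #{p ∈ R | u ⬝ᵥ p ≠ 0} = nonorthCard u := by
  have h := sum_eq_smul_sum_pointSet hR (fun v ↦ if u ⬝ᵥ v ≠ 0 then 1 else 0) (by simp)
    (by intro c hc v; simp [hc])
  rw [← card_filter, ← card_filter] at h
  rw [← smul_eq_mul, ← h, nonorthCard]
  simp only [dotProduct_comm]

lemma card_pointSet_nonorth₂ {R : Finset (Fin k → F)} (hR : IsPointSet R) (e u : Fin k → F) :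
    (Fintype.card F - 1) * #{p ∈ R | e ⬝ᵥ p ≠ 0 ∧ u ⬝ᵥ p ≠ 0} = nonorthCard₂ e u := by
  have h := sum_eq_smul_sum_pointSet hR (fun v ↦ if e ⬝ᵥ v ≠ 0 ∧ u ⬝ᵥ v ≠ 0 then 1 else 0)
    (by simp) (by intro c hc v; simp [hc])
  rw [← card_filter, ← card_filter] at h
  rw [← smul_eq_mul, ← h, nonorthCard₂]
  simp only [dotProduct_comm]

omit [DecidableEq F] in
lemma sum_dotProduct_mul_dotProduct (hk : 2 < (Fintype.card F - 1) * k) (u v : Fin k → F) :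
    ∑ x : Fin k → F, (u ⬝ᵥ x) * (v ⬝ᵥ x) = 0 := by
  let l (w : Fin k → F) : MvPolynomial (Fin k) F := ∑ j, MvPolynomial.C (w j) * MvPolynomial.X j
  have hl (w : Fin k → F) : (l w).totalDegree ≤ 1 := by
    refine (MvPolynomial.totalDegree_finsetSum _ _).trans (Finset.sup_le fun j _ ↦ ?_)
    refine (MvPolynomial.totalDegree_mul _ _).trans ?_
    simp
  have hev (w x : Fin k → F) : MvPolynomial.eval x (l w) = w ⬝ᵥ x := by
    simp [l, dotProduct]
  have h := MvPolynomial.sum_eval_eq_zero (l u * l v) (by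
    have := MvPolynomial.totalDegree_mul (l u) (l v)
    have := hl u
    have := hl v
    simp only [Fintype.card_fin]
    omega)
  simpa [hev] using h

lemma sum_pointSet_dotProduct_mul_dotProduct {R : Finset (Fin k → F)} (hR : IsPointSet R)
    (hsq : ∀ c : F, c ≠ 0 → c * c = 1) (hk : 2 < (Fintype.card F - 1) * k)
    (u v : Fin k → F) : ∑ p ∈ R, (u ⬝ᵥ p) * (v ⬝ᵥ p) = 0 := by
  have h := sum_eq_smul_sum_pointSet hR (fun x ↦ (u ⬝ᵥ x) * (v ⬝ᵥ x)) (by simp) (by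
    intro c hc x
    simp only [dotProduct_smul, smul_eq_mul]
    linear_combination (u ⬝ᵥ x) * (v ⬝ᵥ x) * hsq c hc)
  rw [sum_dotProduct_mul_dotProduct hk, nsmul_eq_mul, Nat.cast_pred Fintype.card_pos,
    Nat.cast_card_eq_zero, zero_sub, neg_one_mul] at h
  simpa using h.symm

lemma le_pointMult_add {ι : Type*} [Fintype ι] (g : ι → Fin k → F) {d : ℕ}
    (hd : ∀ u, u ≠ 0 → d ≤ #{i | u ⬝ᵥ g i ≠ 0}) (p : Fin k → F) (hp : p ≠ 0) :
    Fintype.card F * d ≤ pointMult g p + (Fintype.card F - 1) * #{i | g i ≠ 0} := by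
  have hq : 0 < Fintype.card F := Fintype.card_pos
  have h1 (i : ι) : Fintype.card F * nonorthCard₂ p (g i) =
      nonorthCard p * (if ∃ c : F, c ≠ 0 ∧ g i = c • p then 1 else 0) +
      nonorthCard p * ((Fintype.card F - 1) * (if g i ≠ 0 then 1 else 0)) := by
    by_cases h0 : g i = 0
    · rw [if_neg, if_neg (by simpa using h0)]
      · simp [h0, nonorthCard₂]
      · rintro ⟨c, hc, h⟩
        exact hp ((smul_eq_zero.mp (h.symm.trans h0)).resolve_left hc)
    rw [if_pos h0]
    by_cases h : ∃ c : F, c ≠ 0 ∧ g i = c • p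
    · rw [if_pos h]
      obtain ⟨c, hc, h⟩ := h
      rw [h, nonorthCard₂_smul _ _ hc]
      obtain ⟨n, hn⟩ := Nat.exists_eq_add_of_lt hq
      rw [hn]
      simp
      ring
    · rw [if_neg h]
      have := nonorthCard₂_eq p (g i) h0 fun c hc ↦ h ⟨-c⁻¹, by
        rintro hh
        have hc0 : c = 0 := by simpa using hh
        exact hp (by simpa [hc0] using hc), by
        have hc0 : c ≠ 0 := by
          rintro rfl
          exact hp (by simpa using hc)
        rw [eq_neg_of_add_eq_zero_left hc, smul_neg, neg_smul, neg_neg, smul_smul,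
          inv_mul_cancel₀ hc0, one_smul]⟩
      rw [nonorthCard_eq_of_ne_zero (g i) p h0 hp] at this
      rw [mul_zero, zero_add, mul_one, mul_comm (nonorthCard p), Nat.sub_mul, one_mul]
      omega
  have h2 : ∑ i, nonorthCard₂ p (g i) =
      ∑ u : Fin k → F with u ⬝ᵥ p ≠ 0, #{i | u ⬝ᵥ g i ≠ 0} := by
    simp only [nonorthCard₂, card_filter]
    rw [sum_comm, sum_filter]
    refine sum_congr rfl fun u _ ↦ ?_
    by_cases hu : u ⬝ᵥ p = 0 <;> simp [hu]
  have h3 : nonorthCard p * d ≤ ∑ i, nonorthCard₂ p (g i) := by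
    rw [h2, nonorthCard, ← smul_eq_mul]
    refine card_nsmul_le_sum _ _ _ fun u hu ↦ hd u ?_
    rintro rfl
    simp at hu
  have h4 := sum_congr (rfl : (univ : Finset ι) = univ) fun i _ ↦ h1 i
  simp only [← mul_sum, sum_add_distrib, ← card_filter] at h4
  refine Nat.le_of_mul_le_mul_left ?_ (nonorthCard_pos p hp)
  calc _ = Fintype.card F * (nonorthCard p * d) := by ring
    _ ≤ _ := Nat.mul_le_mul_left _ h3
    _ = _ := h4
    _ = _ := by rw [pointMult]; ring

lemma exists_family_pointMult_eq {R : Finset (Fin k → F)} (hR : IsPointSet R)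
    (M : (Fin k → F) → ℕ) :
    ∃ (n : ℕ) (g : Fin n → Fin k → F), (∀ j, g j ∈ R) ∧ ∀ p ∈ R, pointMult g p = M p := by
  let φ := (Fintype.equivFin (Σ p : R, Fin (M p))).symm
  refine ⟨_, fun j ↦ (φ j).1, fun j ↦ (φ j).1.2, fun p hp ↦ ?_⟩
  have h1 (x : R) : (∃ c : F, c ≠ 0 ∧ (x : Fin k → F) = c • p) ↔ x = ⟨p, hp⟩ := by
    have hx0 : (x : Fin k → F) ≠ 0 := ne_of_mem_of_not_mem x.2 hR.1
    refine ⟨fun h ↦ Subtype.ext ?_, fun h ↦ ⟨1, one_ne_zero, by simp [h]⟩⟩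
    exact (hR.2 _ hx0).unique ⟨x.2, 1, one_ne_zero, (one_smul _ _).symm⟩ ⟨hp, h⟩
  simp only [pointMult, h1, card_filter]
  rw [Equiv.sum_comp φ fun x ↦ if x.1 = ⟨p, hp⟩ then 1 else 0, Fintype.sum_sigma,
    sum_eq_single ⟨p, hp⟩ (fun x _ hx ↦ by simp [hx]) (by simp)]
  simp

lemma sum_add_of_pointMult_add {ι κ A : Type*} [Fintype ι] [Fintype κ] [AddCommMonoid A]
    {R : Finset (Fin k → F)} (hR : IsPointSet R) (g : ι → Fin k → F) (g' : κ → Fin k → F)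
    {e : Fin k → F} {b c : ℕ}
    (h : ∀ p ∈ R, pointMult g' p + b = pointMult g p + if e ⬝ᵥ p ≠ 0 then c else 0)
    (f : (Fin k → F) → A) (hf0 : f 0 = 0) (hf : ∀ c : F, c ≠ 0 → ∀ v, f (c • v) = f v) :
    ∑ j, f (g' j) + b • ∑ p ∈ R, f p = ∑ i, f (g i) + c • ∑ p ∈ R with e ⬝ᵥ p ≠ 0, f p := by
  rw [sum_eq_sum_pointMult hR g f hf0 hf, sum_eq_sum_pointMult hR g' f hf0 hf, ← sum_nsmul,
    ← sum_nsmul, sum_filter, ← sum_add_distrib, ← sum_add_distrib]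
  refine sum_congr rfl fun p hp ↦ ?_
  rw [← add_nsmul, h p hp, add_nsmul]
  split_ifs <;> simp

/-- Remove `a` copies of every projective point from a family of vectors whose associated code has
large minimum weight, while replacing the zero vectors of the family by nonzero ones. -/
lemma exists_reduced_family (hsq : ∀ c : F, c ≠ 0 → c * c = 1) (hk2 : 2 ≤ k)
    (hk : 2 < (Fintype.card F - 1) * k) {R : Finset (Fin k → F)} (hR : IsPointSet R)
    {ι : Type*} [Fintype ι] (g : ι → Fin k → F) {d a : ℕ}
    (ha : (Fintype.card F - 1) * Fintype.card ι + a ≤ Fintype.card F * d)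
    (hd : ∀ u, u ≠ 0 → d ≤ #{i | u ⬝ᵥ g i ≠ 0})
    (hd' : ∃ u, u ≠ 0 ∧ #{i | u ⬝ᵥ g i ≠ 0} = d) :
    ∃ (n : ℕ) (g' : Fin n → Fin k → F), n + a * #R = Fintype.card ι ∧ (∀ j, g' j ≠ 0) ∧
      (∀ u v, ∑ j, (u ⬝ᵥ g' j) * (v ⬝ᵥ g' j) = ∑ i, (u ⬝ᵥ g i) * (v ⬝ᵥ g i)) ∧
      (∀ u, u ≠ 0 → d ≤ #{j | u ⬝ᵥ g' j ≠ 0} + a * Fintype.card F ^ (k - 1)) ∧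
      ∃ u, u ≠ 0 ∧ #{j | u ⬝ᵥ g' j ≠ 0} + a * Fintype.card F ^ (k - 1) = d := by
  obtain ⟨u₀, hu₀, hu₀d⟩ := hd'
  obtain ⟨e, he, hue⟩ : ∃ e : Fin k → F, e ≠ 0 ∧ ∀ c : F, e + c • u₀ ≠ 0 := by
    obtain ⟨j, hj⟩ := Function.ne_iff.mp hu₀
    have : Nontrivial (Fin k) := Fin.nontrivial_iff_two_le.mpr hk2
    obtain ⟨j', hj'⟩ := exists_ne j
    refine ⟨Pi.single j' 1, by simp, fun c hc ↦ ?_⟩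
    have h1 := congrFun hc j
    have h2 := congrFun hc j'
    have hc0 : c = 0 := (by simpa [hj'.symm] using h1 : c = 0 ∨ u₀ j = 0).resolve_right hj
    simp [hc0] at h2
  set q := Fintype.card F with hq
  have hqpos : 0 < q := Fintype.card_pos
  have hq1 : 0 < q - 1 := Nat.pos_of_ne_zero fun h ↦ by simp [h] at hk
  set z := #{i | g i = 0} with hz
  have hzn : #{i | g i ≠ 0} + z = Fintype.card ι := by
    rw [add_comm, hz, card_filter_add_card_filter_not, card_univ]
  have hpos (p) (hp : p ∈ R) : a + (q - 1) * z ≤ pointMult g p := by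
    have h := le_pointMult_add g hd p (ne_of_mem_of_not_mem hp hR.1)
    rw [← hq] at h
    rw [← hzn, mul_add] at ha
    omega
  let M (p : Fin k → F) : ℕ :=
    pointMult g p + (if e ⬝ᵥ p ≠ 0 then q * z else 0) - (a + (q - 1) * z)
  obtain ⟨n, g', hg'R, hg'M⟩ := exists_family_pointMult_eq hR M
  have hM (p) (hp : p ∈ R) : pointMult g' p + (a + (q - 1) * z) =
      pointMult g p + (if e ⬝ᵥ p ≠ 0 then q * z else 0) := by
    rw [hg'M p hp]
    exact Nat.sub_add_cancel ((hpos p hp).trans (Nat.le_add_right _ _))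
  have hg' (j) : g' j ≠ 0 := ne_of_mem_of_not_mem (hg'R j) hR.1
  have hcardR : (q - 1) * #R + 1 = q ^ k := card_pointSet hR
  have hA (u : Fin k → F) (hu : u ≠ 0) : #{p ∈ R | u ⬝ᵥ p ≠ 0} = q ^ (k - 1) := by
    have h1 := nonorthCard_eq u hu
    rw [← card_pointSet_nonorth hR u, ← hq] at h1
    obtain ⟨b, hb⟩ : ∃ b, q = b + 1 := ⟨q - 1, by omega⟩
    obtain ⟨l, rfl⟩ : ∃ l, k = l + 1 := ⟨k - 1, by omega⟩
    have hb0 : 0 < b := by omega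
    rw [hb] at h1 ⊢
    simp only [Nat.add_sub_cancel] at h1 ⊢
    rw [pow_succ] at h1
    have h2 : (b + 1) * b * #{p ∈ R | u ⬝ᵥ p ≠ 0} = (b + 1) * b * (b + 1) ^ l := by
      linarith
    exact Nat.eq_of_mul_eq_mul_left (by positivity) h2
  have hY (u : Fin k → F) (hu : ∀ c : F, e + c • u ≠ 0) (hu0 : u ≠ 0) :
      q * #{p ∈ R | e ⬝ᵥ p ≠ 0 ∧ u ⬝ᵥ p ≠ 0} = (q - 1) * q ^ (k - 1) := by
    have h1 := nonorthCard₂_eq e u hu0 hu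
    rw [← card_pointSet_nonorth₂ hR, ← card_pointSet_nonorth hR, hA u hu0, ← hq] at h1
    obtain ⟨b, hb⟩ : ∃ b, q = b + 1 := ⟨q - 1, by omega⟩
    have hb0 : 0 < b := by omega
    rw [hb] at h1 ⊢
    simp only [Nat.add_sub_cancel] at h1 ⊢
    exact Nat.eq_of_mul_eq_mul_left hb0 (by linarith)
  have hY' (u : Fin k → F) (hu0 : u ≠ 0) :
      (q - 1) * q ^ (k - 1) ≤ q * #{p ∈ R | e ⬝ᵥ p ≠ 0 ∧ u ⬝ᵥ p ≠ 0} := by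
    by_cases hu : ∀ c : F, e + c • u ≠ 0
    · exact (hY u hu hu0).ge
    · push Not at hu
      obtain ⟨c, hc⟩ := hu
      have hec : e = (-c) • u := by rw [eq_neg_of_add_eq_zero_left hc, neg_smul]
      have hc0 : c ≠ 0 := by
        rintro rfl
        exact he (by simpa using hc)
      have h1 : ({p ∈ R | e ⬝ᵥ p ≠ 0 ∧ u ⬝ᵥ p ≠ 0} : Finset (Fin k → F)) =
          {p ∈ R | u ⬝ᵥ p ≠ 0} := by
        refine filter_congr fun p _ ↦ ?_
        simp [hec, hc0]
      rw [h1, hA u hu0]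
      exact Nat.mul_le_mul_right _ (Nat.sub_le _ _)
  have hW (u : Fin k → F) (hu : u ≠ 0) :
      #{j | u ⬝ᵥ g' j ≠ 0} + a * q ^ (k - 1) + z * ((q - 1) * q ^ (k - 1)) =
        #{i | u ⬝ᵥ g i ≠ 0} + z * (q * #{p ∈ R | e ⬝ᵥ p ≠ 0 ∧ u ⬝ᵥ p ≠ 0}) := by
    have h := sum_add_of_pointMult_add hR g g' hM (fun v ↦ if u ⬝ᵥ v ≠ 0 then 1 else 0) (by simp)
      (by intro c hc v; simp [hc])
    simp only [← card_filter, filter_filter, smul_eq_mul] at h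
    rw [hA u hu] at h
    linarith
  refine ⟨n, g', ?_, hg', fun u v ↦ ?_, fun u hu ↦ ?_, u₀, hu₀, ?_⟩
  · have h := sum_add_of_pointMult_add hR g g' hM (fun v ↦ if v ≠ 0 then 1 else 0) (by simp)
      (by intro c hc v; simp [hc])
    simp only [← card_filter, filter_filter, smul_eq_mul] at h
    rw [filter_true_of_mem fun j _ ↦ hg' j, card_univ, Fintype.card_fin,
      filter_true_of_mem (s := R) fun p hp ↦ ne_of_mem_of_not_mem hp hR.1] at h
    have h1 : ({p ∈ R | e ⬝ᵥ p ≠ 0 ∧ p ≠ 0} : Finset (Fin k → F)) =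
        {p ∈ R | e ⬝ᵥ p ≠ 0} := by
      refine filter_congr fun p hp ↦ ?_
      simp [ne_of_mem_of_not_mem hp hR.1]
    have h2 : q * q ^ (k - 1) = q ^ k := by
      rw [← pow_succ', Nat.sub_add_cancel (by omega)]
    rw [h1, hA e he, mul_right_comm, h2, ← hcardR] at h
    rw [← hzn]
    linarith
  · have h := sum_add_of_pointMult_add hR g g' hM (fun x ↦ (u ⬝ᵥ x) * (v ⬝ᵥ x)) (by simp) (by
      intro c hc x
      simp only [dotProduct_smul, smul_eq_mul]
      linear_combination (u ⬝ᵥ x) * (v ⬝ᵥ x) * hsq c hc)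
    rw [sum_pointSet_dotProduct_mul_dotProduct hR hsq hk] at h
    simpa [hq] using h
  · have h := hW u hu
    have h1 := Nat.mul_le_mul_left z (hY' u hu)
    have h2 := hd u hu
    omega
  · have h := hW u₀ hu₀
    rw [hY u₀ hue hu₀, hu₀d] at h
    omega

end PointSets

section Codes

variable {F : Type*} [Field F] [DecidableEq F] {k n : ℕ}

lemma exists_family_of_code (C : Submodule F (Fin n → F)) (hC : Module.finrank F C = k)
    (hLCD : IsLCD C) {d : ℕ} (hd : HasMinWeight C d) :
    ∃ g : Fin n → Fin k → F,
      (∀ u, (∀ v, ∑ i, (u ⬝ᵥ g i) * (v ⬝ᵥ g i) = 0) → u = 0) ∧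
      (∀ u, u ≠ 0 → d ≤ #{i | u ⬝ᵥ g i ≠ 0}) ∧
      ∃ u, u ≠ 0 ∧ #{i | u ⬝ᵥ g i ≠ 0} = d := by
  let b := Module.finBasisOfFinrankEq F C hC
  let g (i : Fin n) (j : Fin k) : F := (b j : Fin n → F) i
  have hg (u : Fin k → F) (i : Fin n) : u ⬝ᵥ g i = (b.equivFun.symm u : Fin n → F) i := by
    simp [Module.Basis.equivFun_symm_apply, g, dotProduct]
  have hwt (u : Fin k → F) :
      #{i | u ⬝ᵥ g i ≠ 0} = wt (b.equivFun.symm u : Fin n → F) := by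
    simp only [hg, wt]
  have hne (u : Fin k → F) (hu : u ≠ 0) : (b.equivFun.symm u : Fin n → F) ≠ 0 := fun h ↦
    hu ((map_eq_zero_iff _ b.equivFun.symm.injective).mp (Subtype.ext h))
  refine ⟨g, fun u hu ↦ ?_, fun u hu ↦ ?_, ?_⟩
  · by_contra hu0
    refine hne u hu0 ?_
    rw [← Submodule.mem_bot F, ← hLCD]
    refine ⟨(b.equivFun.symm u).2, fun y hy ↦ ?_⟩
    have h := hu (b.equivFun ⟨y, hy⟩)
    simpa only [hg, LinearEquiv.symm_apply_apply] using h
  · rw [hwt]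
    exact hd.2 _ (b.equivFun.symm u).2 (hne u hu)
  · obtain ⟨x, hx, hx0, hxd⟩ := hd.1
    refine ⟨b.equivFun ⟨x, hx⟩, by simpa using hx0, ?_⟩
    rw [hwt, LinearEquiv.symm_apply_apply, hxd]

lemma exists_code_of_family (g : Fin n → Fin k → F) (hg : ∀ i, g i ≠ 0) {d : ℕ}
    (hgram : ∀ u, (∀ v, ∑ i, (u ⬝ᵥ g i) * (v ⬝ᵥ g i) = 0) → u = 0)
    (hd : ∀ u, u ≠ 0 → d ≤ #{i | u ⬝ᵥ g i ≠ 0})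
    (hd' : ∃ u, u ≠ 0 ∧ #{i | u ⬝ᵥ g i ≠ 0} = d) :
    ∃ C : Submodule F (Fin n → F),
      Module.finrank F C = k ∧ IsLCD C ∧ HasMinWeight C d ∧ DualDistGe C 2 := by
  let L : (Fin k → F) →ₗ[F] (Fin n → F) := Matrix.mulVecLin (Matrix.of g)
  have hL (u i) : L u i = u ⬝ᵥ g i := by
    simp [L, mulVec, dotProduct_comm]
  have hinj : Function.Injective L := by
    rw [injective_iff_map_eq_zero]
    intro u hu
    refine hgram u fun v ↦ sum_eq_zero fun i _ ↦ ?_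
    rw [← hL u, hu]
    simp
  refine ⟨LinearMap.range L, ?_, ?_, ⟨?_, ?_⟩, ?_⟩
  · rw [LinearMap.finrank_range_of_inj hinj]
    simp
  · rw [IsLCD, Submodule.eq_bot_iff]
    rintro _ ⟨⟨u, rfl⟩, hu⟩
    rw [hgram u fun v ↦ by simpa only [hL] using hu (L v) ⟨v, rfl⟩, map_zero]
  · obtain ⟨u, hu, hud⟩ := hd'
    refine ⟨L u, ⟨u, rfl⟩, (map_ne_zero_iff L hinj).mpr hu, ?_⟩
    simpa only [wt, hL] using hud
  · rintro _ ⟨u, rfl⟩ hu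
    simpa only [wt, hL] using hd u fun h ↦ hu (by rw [h, map_zero])
  · intro x hx hx0
    by_contra! hlt
    obtain ⟨i, hi⟩ := Function.ne_iff.mp hx0
    have hx1 (j : Fin n) (hj : x j ≠ 0) : j = i :=
      card_le_one.mp (Nat.le_of_lt_succ hlt) j (by simpa using hj) i (by simpa using hi)
    refine hg i (funext fun j ↦ ?_)
    have h := hx (L (Pi.single j 1)) ⟨_, rfl⟩
    rw [sum_eq_single i (fun l _ hl ↦ by
      rw [by_contra fun h ↦ hl (hx1 l h), zero_mul]) (by simp), hL] at h
    simpa using (mul_eq_zero.mp h).resolve_left hi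

end Codes

lemma sub_one_mul_qrep_add_one {q : ℕ} (hq : 0 < q) (k : ℕ) :
    (q - 1) * qrep q k + 1 = q ^ k := by
  obtain ⟨b, rfl⟩ : ∃ b, q = b + 1 := ⟨q - 1, by omega⟩
  simpa [qrep, mul_comm] using geom_sum_mul_add b k

/-- If there is no LCD `[q·r, k, (q−1)·r]` code over `𝔽_q` with dual distance `≥ 2`,
then for every `s ≥ s' = (q·r − t)/[k]_q + 1` (encoded by `q·r = [k]_q·(s'−1) + t` via
`s'' = s'−1`) there is no LCD `[[k]_q·s + t, k, q^{k-1}·s + α]` code over `𝔽_q`, where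
`r = q^{k-1}·t − [k]_q·α`. -/
theorem no_lcd_family {q k₀ k t r s'' : ℕ} {α : ℤ}
    (hq : (q = 2 ∧ k₀ = 3) ∨ (q = 3 ∧ k₀ = 2)) (hk : k₀ ≤ k)
    (ht : t < qrep q k)
    (hr : (r : ℤ) = (q : ℤ) ^ (k - 1) * t - (qrep q k : ℤ) * α)
    (hs : q * r = qrep q k * s'' + t)
    (hqr : k ≤ q * r)
    (h : ¬ ∃ C₀ : Submodule (ZMod q) (Fin (q * r) → ZMod q),
      Module.finrank (ZMod q) C₀ = k ∧ IsLCD C₀ ∧ HasMinWeight C₀ ((q - 1) * r) ∧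
      DualDistGe C₀ 2) :
    ∀ s : ℕ, s'' + 1 ≤ s → k ≤ qrep q k * s + t →
      ∀ w : ℕ, (w : ℤ) = (q : ℤ) ^ (k - 1) * s + α →
        ¬ ∃ C : Submodule (ZMod q) (Fin (qrep q k * s + t) → ZMod q),
          Module.finrank (ZMod q) C = k ∧ IsLCD C ∧ HasMinWeight C w := by
  rintro s hs1 hks w hw ⟨C, hC, hLCD, hmin⟩
  have hsq : ∀ c : ZMod q, c ≠ 0 → c * c = 1 := by
    rcases hq with ⟨rfl, -⟩ | ⟨rfl, -⟩ <;> decide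
  have hprime : Fact q.Prime := ⟨by rcases hq with ⟨rfl, -⟩ | ⟨rfl, -⟩ <;> norm_num⟩
  have hq0 : 0 < q := hprime.out.pos
  have hk2 : 2 ≤ k := by omega
  have hk' : 2 < (Fintype.card (ZMod q) - 1) * k := by
    rw [ZMod.card]
    rcases hq with ⟨rfl, rfl⟩ | ⟨rfl, rfl⟩ <;> omega
  obtain ⟨R, hR⟩ := exists_isPointSet (F := ZMod q) (k := k)
  have hqrep := sub_one_mul_qrep_add_one hq0 k
  have hRcard : #R = qrep q k := by
    have h1 := card_pointSet hR
    rw [ZMod.card, ← hqrep] at h1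
    refine Nat.eq_of_mul_eq_mul_left ?_ (Nat.add_right_cancel h1)
    have := hprime.out.two_le
    omega
  have hpos : (0 : ℤ) < qrep q k := by exact_mod_cast ht.pos
  have hpow : (q : ℤ) * q ^ (k - 1) = (q - 1) * qrep q k + 1 := by
    rw [← pow_succ', Nat.sub_add_cancel (by omega)]
    have h1 : (((q - 1 : ℕ) : ℤ)) * qrep q k + 1 = q ^ k := by exact_mod_cast hqrep
    rw [← h1]
    push_cast [Nat.cast_sub hq0]
    ring
  have hs'' : (s'' : ℤ) = (q - 1) * t - q * α := by
    refine mul_left_cancel₀ hpos.ne' ?_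
    have h1 : (q : ℤ) * r = qrep q k * s'' + t := by exact_mod_cast hs
    linear_combination (q : ℤ) * hr - h1 + t * hpow
  obtain ⟨a, rfl⟩ : ∃ a, s = s'' + a := ⟨s - s'', by omega⟩
  obtain ⟨g, hgram, hd, hd'⟩ := exists_family_of_code C hC hLCD hmin
  obtain ⟨n, g', hn, hg', hgram', hwt, u, hu, huwt⟩ :=
    exists_reduced_family hsq hk2 hk' hR g (d := w) (a := a) (by
      rw [ZMod.card, Fintype.card_fin]
      zify [Nat.one_le_iff_ne_zero.mpr hq0.ne']
      rw [hw]
      push_cast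
      refine le_of_eq ?_
      linear_combination (-(s'' : ℤ) - a) * hpow - hs'') hd hd'
  rw [ZMod.card] at hwt huwt
  obtain rfl : n = q * r := by
    rw [hRcard, Fintype.card_fin] at hn
    rw [hs]
    linarith
  have hwr : w = (q - 1) * r + a * q ^ (k - 1) := by
    zify [Nat.one_le_iff_ne_zero.mpr hq0.ne']
    rw [hw, hr]
    push_cast
    linear_combination (q : ℤ) ^ (k - 1) * hs'' - α * hpow
  refine h (exists_code_of_family g' hg' (fun u hu ↦ hgram u fun v ↦ ?_) (fun u hu ↦ ?_)
    ⟨u, hu, by omega⟩)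
  · rw [← hgram', hu]
  · have := hwt u hu
    omega
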